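/- Let P be a simple polygon in the plane with vertices v_0, …, v_{n-1} in counterclockwise order (indices mod n), with no three distinct vertices collinear. Let i be an index and j = i + k (mod n) with 2 ≤ k ≤ n − 1, so that the chain ch(v_{i+1}, v_{j-1}) = (v_{i+1}, …, v_{i+k-1}) is nonempty. Then v_i is visible to v_j if and only if there exists t ∈ {1, …, k − 1} such that the chain vertex v_{i+t} is a triangle witness for (v_i, v_j), i.e., v_{i+t} is visible to both v_i and v_j and the solid triangle conv{v_i, v_{i+t}, v_j} is contained in P. -/

import Mathlib

/-- A point in the Euclidean plane. -/
abbrev Plane := ℝ × ℝ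

/-- A simple polygon with `n` vertices `v 0, …, v (n-1)` in counterclockwise order
(indices mod `n`), given as a compact region `P` of the plane that is the closure of its
interior, whose frontier is the union of the closed edge segments `[v i, v (i+1)]`,
such that consecutive edges meet exactly in their common endpoint and non-consecutive
edges are disjoint; moreover no three distinct vertices are collinear. -/
structure SimplePolygon (n : ℕ) where
  three_le : 3 ≤ n
  v : ZMod n → Plane
  inj : Function.Injective v
  P : Set Plane
  compact : IsCompact P
  regular : P = closure (interior P)
  frontier_eq : frontier P = ⋃ i : ZMod n, segment ℝ (v i) (v (i + 1))
  edges_consecutive : ∀ i : ZMod n,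
    segment ℝ (v i) (v (i + 1)) ∩ segment ℝ (v (i + 1)) (v (i + 1 + 1)) = {v (i + 1)}
  edges_disjoint : ∀ i j : ZMod n, i ≠ j → j ≠ i + 1 → i ≠ j + 1 →
    Disjoint (segment ℝ (v i) (v (i + 1))) (segment ℝ (v j) (v (j + 1)))
  no_three_collinear : ∀ a b c : ZMod n, a ≠ b → a ≠ c → b ≠ c →
    ¬ Collinear ℝ ({v a, v b, v c} : Set Plane)

/-- `a` is visible to `b` in `P`: the closed segment `[a, b]` is contained in `P`. -/
def Visible (P : Set Plane) (a b : Plane) : Prop := segment ℝ a b ⊆ P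

/-- Twice the signed area of the triangle `p q z`. -/
def cross (p q z : Plane) : ℝ := (q.1 - p.1) * (z.2 - p.2) - (q.2 - p.2) * (z.1 - p.1)

lemma cross_combo (p q x y : Plane) {s t : ℝ} (h : s + t = 1) :
    cross p q (s • x + t • y) = s * cross p q x + t * cross p q y := by
  obtain rfl : s = 1 - t := by linarith
  simp only [cross, Prod.fst_add, Prod.snd_add, Prod.smul_fst, Prod.smul_snd, smul_eq_mul]
  ring

lemma cross_eq_zero_of_mem_segment {p q z : Plane} (h : z ∈ segment ℝ p q) :
    cross p q z = 0 := by
  obtain ⟨s, t, -, -, hst, rfl⟩ := h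
  rw [cross_combo p q p q hst]
  simp only [cross]
  ring

/-- Points of a non-horizontal line are ordered by their height. -/
lemma mem_segment_of_cross_eq_zero {p q x y z : Plane} (hpq : p.2 ≠ q.2)
    (hx : cross p q x = 0) (hy : cross p q y = 0) (hz : cross p q z = 0)
    (hxz : x.2 ≤ z.2) (hzy : z.2 ≤ y.2) (hxy : x.2 < y.2) : z ∈ segment ℝ x y := by
  have hD : q.2 - p.2 ≠ 0 := sub_ne_zero.2 hpq.symm
  have hd : 0 < y.2 - x.2 := by linarith
  have key : (z.1 - x.1) * (y.2 - x.2) = (y.1 - x.1) * (z.2 - x.2) := by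
    apply mul_left_cancel₀ hD
    simp only [cross] at hx hy hz
    linear_combination (y.2 - z.2) * hx + (z.2 - x.2) * hy - (y.2 - x.2) * hz
  refine ⟨(y.2 - z.2) / (y.2 - x.2), (z.2 - x.2) / (y.2 - x.2),
    div_nonneg (by linarith) hd.le, div_nonneg (by linarith) hd.le, ?_, ?_⟩
  · field_simp
    ring
  · ext
    · simp only [Prod.fst_add, Prod.smul_fst, smul_eq_mul]
      field_simp
      linear_combination -key
    · simp only [Prod.snd_add, Prod.smul_snd, smul_eq_mul]
      field_simp
      ring

lemma exists_mem_segment_snd_eq {p q : Plane} {h : ℝ} (hp : p.2 ≤ h) (hq : h < q.2) :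
    ∃ w ∈ segment ℝ p q, w.2 = h := by
  have hd : 0 < q.2 - p.2 := by linarith
  refine ⟨((q.2 - h) / (q.2 - p.2)) • p + ((h - p.2) / (q.2 - p.2)) • q,
    ⟨_, _, div_nonneg (by linarith) hd.le, div_nonneg (by linarith) hd.le, ?_, rfl⟩, ?_⟩
  · field_simp
    ring
  · simp only [Prod.snd_add, Prod.smul_snd, smul_eq_mul]
    field_simp
    ring

lemma snd_le_max_of_mem_segment {p q z : Plane} (h : z ∈ segment ℝ p q) :
    z.2 ≤ max p.2 q.2 := by
  obtain ⟨s, t, hs, ht, hst, rfl⟩ := h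
  simp only [Prod.snd_add, Prod.smul_snd, smul_eq_mul]
  calc s * p.2 + t * q.2 ≤ s * max p.2 q.2 + t * max p.2 q.2 := by
        gcongr
        exacts [le_max_left _ _, le_max_right _ _]
    _ = max p.2 q.2 := by rw [← add_mul, hst, one_mul]

lemma min_le_snd_of_mem_segment {p q z : Plane} (h : z ∈ segment ℝ p q) :
    min p.2 q.2 ≤ z.2 := by
  obtain ⟨s, t, hs, ht, hst, rfl⟩ := h
  simp only [Prod.snd_add, Prod.smul_snd, smul_eq_mul]
  calc min p.2 q.2 = s * min p.2 q.2 + t * min p.2 q.2 := by rw [← add_mul, hst, one_mul]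
    _ ≤ s * p.2 + t * q.2 := by
        gcongr
        exacts [min_le_left _ _, min_le_right _ _]

/-- Walking along a segment from a point satisfying finitely many affine constraints to a point
violating one of them, there is a last point at which all of them hold. -/
lemma exists_mem_segment_forall_nonneg {α : Type*} {K : Set α} (hK : K.Finite)
    (φ : α → Plane → ℝ)
    (hφ : ∀ f x y (s t : ℝ), s + t = 1 → φ f (s • x + t • y) = s * φ f x + t * φ f y)
    {r p : Plane} (hr : ∀ f ∈ K, 0 ≤ φ f r) (hp : ∃ f ∈ K, φ f p < 0) :
    ∃ s ∈ segment ℝ r p, (∀ f ∈ K, 0 ≤ φ f s) ∧ ∃ f ∈ K, φ f s = 0 ∧ φ f p < 0 := by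
  obtain ⟨f, ⟨hfK, hfp⟩, hmin⟩ := Set.exists_min_image {f ∈ K | φ f p < 0}
    (fun f => φ f r / (φ f r - φ f p)) (hK.subset (Set.sep_subset _ _)) hp
  have hd : 0 < φ f r - φ f p := by linarith [hr f hfK]
  set τ := φ f r / (φ f r - φ f p) with hτ
  have hτ0 : 0 ≤ τ := div_nonneg (hr f hfK) hd.le
  have hτ1 : τ ≤ 1 := (div_le_one hd).2 (by linarith)
  refine ⟨(1 - τ) • r + τ • p, ⟨_, _, by linarith, hτ0, by ring, rfl⟩, fun g hg => ?_,
    f, hfK, ?_, hfp⟩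
  · rw [hφ g _ _ _ _ (by ring)]
    rcases lt_or_ge (φ g p) 0 with hgp | hgp
    · have hd' : 0 < φ g r - φ g p := by linarith [hr g hg]
      have := (le_div_iff₀ hd').1 (hmin g ⟨hg, hgp⟩)
      linarith
    · have := mul_nonneg (sub_nonneg.2 hτ1) (hr g hg)
      have := mul_nonneg hτ0 hgp
      linarith
  · rw [hφ f _ _ _ _ (by ring), hτ]
    field_simp
    ring

/-- The affine function vanishing on the line of `e`, scaled so as to be nonnegative
at `(1/2, 0)`. -/
noncomputable def barrier (e : Plane × Plane) (z : Plane) : ℝ :=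
  cross e.1 e.2 (1 / 2, 0) * cross e.1 e.2 z

lemma barrier_combo (e : Plane × Plane) (x y : Plane) (s t : ℝ) (h : s + t = 1) :
    barrier e (s • x + t • y) = s * barrier e x + t * barrier e y := by
  simp only [barrier, cross_combo _ _ _ _ h]
  ring

lemma barrier_eq_zero_of_mem_segment {e : Plane × Plane} {z : Plane}
    (h : z ∈ segment ℝ e.1 e.2) : barrier e z = 0 := by
  rw [barrier, cross_eq_zero_of_mem_segment h, mul_zero]

lemma barrier_nonneg_of_mem_segment {e : Plane × Plane} {x y z : Plane} (hx : 0 ≤ barrier e x)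
    (hy : 0 ≤ barrier e y) (hz : z ∈ segment ℝ x y) : 0 ≤ barrier e z := by
  obtain ⟨s, t, hs, ht, hst, rfl⟩ := hz
  rw [barrier_combo e x y s t hst]
  positivity

/-- A finite planar straight-line arrangement, symmetric under reversal of edges, whose edges
meet only in endpoints, and such that no edge reaching above the horizontal axis meets
the open base `(0, 1) × {0}`. -/
structure Arrangement (E : Set (Plane × Plane)) : Prop where
  finite : E.Finite
  symm : ∀ p q, (p, q) ∈ E → (q, p) ∈ E
  inter : ∀ e ∈ E, ∀ f ∈ E, ∀ z ∈ segment ℝ e.1 e.2, z ∈ segment ℝ f.1 f.2 →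
    z = f.1 ∨ z = f.2 ∨ segment ℝ e.1 e.2 = segment ℝ f.1 f.2
  base : ∀ e ∈ E, 0 < e.2.2 → ∀ x : ℝ, 0 < x → x < 1 → ((x, 0) : Plane) ∉ segment ℝ e.1 e.2

/-- The edges of an arrangement crossing from the closed lower to the open upper half-plane. -/
def upEdges (E : Set (Plane × Plane)) : Set (Plane × Plane) := {e ∈ E | e.1.2 ≤ 0 ∧ 0 < e.2.2}

/-- The upward edges that are innermost at height `δ`. -/
def innerEdges (E : Set (Plane × Plane)) (δ : ℝ) : Set (Plane × Plane) :=
  {e ∈ upEdges E | ∀ w ∈ segment ℝ e.1 e.2, w.2 = δ → ∀ f ∈ upEdges E, 0 ≤ barrier f w}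

/-- The part above height `δ` of the region cut out by the innermost edges. -/
def innerZone (E : Set (Plane × Plane)) (δ : ℝ) : Set Plane :=
  {z | δ ≤ z.2 ∧ ∀ f ∈ innerEdges E δ, 0 ≤ barrier f z}

/-- A height below all vertices of the open upper half-plane at which the upward edges have not
yet crossed the vertical line through `(1/2, 0)`. -/
structure IsLowHeight (E : Set (Plane × Plane)) (δ : ℝ) : Prop where
  pos : 0 < δ
  lt : ∀ e ∈ E, 0 < e.2.2 → δ < e.2.2
  barrier_pos : ∀ e ∈ upEdges E, 0 < barrier e (1 / 2, δ)

namespace Arrangement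

variable {E : Set (Plane × Plane)} {δ : ℝ}

lemma barrier_base (hE : Arrangement E) {e : Plane × Plane} (he : e ∈ upEdges E) :
    0 < barrier e (1 / 2, 0) ∧ 0 ≤ barrier e (0, 0) ∧ 0 ≤ barrier e (1, 0) := by
  obtain ⟨p, q⟩ := e
  obtain ⟨heE, hp, hq⟩ := he
  dsimp only at hp hq
  have hD : 0 < q.2 - p.2 := by linarith
  have key : ∀ x : ℝ, 0 < x → x < 1 → cross p q (x, 0) ≠ 0 := by
    intro x h0 h1 hx
    refine hE.base _ heE hq x h0 h1 (mem_segment_of_cross_eq_zero (p := p) (q := q) ?_ ?_ ?_ hx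
      hp hq.le (by linarith))
    · linarith
    · exact cross_eq_zero_of_mem_segment (left_mem_segment ℝ p q)
    · exact cross_eq_zero_of_mem_segment (right_mem_segment ℝ p q)
  have hlin : ∀ x : ℝ, cross p q (x, 0) = cross p q (0, 0) - x * (q.2 - p.2) := by
    intro x
    simp only [cross]
    ring
  have hx : cross p q (0, 0) / (q.2 - p.2) * (q.2 - p.2) = cross p q (0, 0) :=
    div_mul_cancel₀ _ hD.ne'
  set x := cross p q (0, 0) / (q.2 - p.2) with hxdef
  have hx01 : x ≤ 0 ∨ 1 ≤ x := by
    by_contra! h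
    exact key x h.1 h.2 (by rw [hlin, hx, sub_self])
  have h2 := key (1 / 2) (by norm_num) (by norm_num)
  simp only [barrier]
  refine ⟨mul_self_pos.2 h2, ?_, ?_⟩
  · rw [hlin (1 / 2), ← hx]
    rcases hx01 with h | h
    · nlinarith [mul_pos hD hD, mul_nonneg (mul_pos hD hD).le (neg_nonneg.2 h)]
    · nlinarith [mul_pos hD hD, mul_nonneg (mul_pos hD hD).le (sub_nonneg.2 h)]
  · rw [hlin (1 / 2), hlin 1, ← hx]
    rcases hx01 with h | h
    · nlinarith [mul_pos hD hD, mul_nonneg (mul_pos hD hD).le (neg_nonneg.2 h)]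
    · nlinarith [mul_pos hD hD, mul_nonneg (mul_pos hD hD).le (sub_nonneg.2 h)]

lemma exists_isLowHeight (hE : Arrangement E) : ∃ δ : ℝ, IsLowHeight E δ := by
  have h1 : ∀ᶠ δ : ℝ in nhdsWithin 0 (Set.Ioi 0), ∀ e ∈ E, 0 < e.2.2 → δ < e.2.2 := by
    rw [Filter.eventually_all_finite hE.finite]
    intro e _
    rw [Filter.eventually_imp_distrib_left]
    intro h
    exact nhdsWithin_le_nhds (Iio_mem_nhds h)
  have h2 : ∀ᶠ δ : ℝ in nhdsWithin 0 (Set.Ioi 0), ∀ e ∈ upEdges E, 0 < barrier e (1 / 2, δ) := by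
    refine (Filter.eventually_all_finite
      (hE.finite.subset (Set.sep_subset _ _ : upEdges E ⊆ E))).2 fun e he => ?_
    have hc : Continuous fun δ : ℝ => barrier e (1 / 2, δ) := by
      unfold barrier cross
      fun_prop
    exact nhdsWithin_le_nhds (hc.continuousAt.eventually_const_lt (hE.barrier_base he).1)
  obtain ⟨δ, ⟨h1, h2⟩, h0⟩ := ((h1.and h2).and self_mem_nhdsWithin).exists
  exact ⟨δ, h0, h1, h2⟩

lemma cross_eq_zero_of_barrier (hE : Arrangement E) {f : Plane × Plane} (hf : f ∈ upEdges E)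
    {s : Plane} (hs : barrier f s = 0) :
    cross f.1 f.2 s = 0 := by
  rcases mul_eq_zero.1 hs with h | h
  · have := (hE.barrier_base hf).1
    rw [barrier, h] at this
    simp at this
  · exact h

/-- An edge along which an innermost barrier changes sign yields a vertex in the zone. -/
lemma exists_vertex_of_exit (hE : Arrangement E) (hδ : IsLowHeight E δ)
    {e : Plane × Plane} (he : e ∈ E) {r p : Plane}
    (hr : r ∈ segment ℝ e.1 e.2) (hp : p ∈ segment ℝ e.1 e.2) (hrz : r ∈ innerZone E δ)
    (hpδ : δ ≤ p.2) (hpz : p ∉ innerZone E δ) :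
    ∃ f ∈ E, f.2 ∈ innerZone E δ ∧ f.2.2 ≤ max r.2 p.2 := by
  have hKfin : (innerEdges E δ).Finite :=
    hE.finite.subset ((Set.sep_subset _ _).trans (Set.sep_subset _ _))
  have hpf : ∃ f ∈ innerEdges E δ, barrier f p < 0 := by
    by_contra! h
    exact hpz ⟨hpδ, h⟩
  obtain ⟨s, hs, hsK, f, hfK, hfs, hfp⟩ :=
    exists_mem_segment_forall_nonneg hKfin barrier barrier_combo hrz.2 hpf
  have hfU := hfK.1
  have hδ0 := hδ.pos
  have hsmax := snd_le_max_of_mem_segment hs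
  have hsmin : δ ≤ s.2 := (le_min hrz.1 hpδ).trans (min_le_snd_of_mem_segment hs)
  have hse : s ∈ segment ℝ e.1 e.2 := (convex_segment _ _).segment_subset hr hp hs
  have hfc := hE.cross_eq_zero_of_barrier hfU hfs
  have hne : f.1.2 ≠ f.2.2 := by linarith [hfU.2.1, hfU.2.2]
  rcases le_or_gt s.2 f.2.2 with h | h
  · have hsf : s ∈ segment ℝ f.1 f.2 := mem_segment_of_cross_eq_zero hne
      (cross_eq_zero_of_mem_segment (left_mem_segment ℝ _ _))
      (cross_eq_zero_of_mem_segment (right_mem_segment ℝ _ _)) hfc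
      (by linarith [hfU.2.1]) h (by linarith [hfU.2.1, hfU.2.2])
    rcases hE.inter e he f hfU.1 s hse hsf with h1 | h1 | h1
    · rw [h1] at hsmin
      linarith [hfU.2.1]
    · exact ⟨f, hfU.1, h1 ▸ ⟨hsmin, hsK⟩, h1 ▸ hsmax⟩
    · rw [h1] at hp
      linarith [barrier_eq_zero_of_mem_segment hp]
  · have hfδ := hδ.lt f hfU.1 hfU.2.2
    obtain ⟨w, hw, hwδ⟩ := exists_mem_segment_snd_eq (p := f.1) (q := f.2) (h := δ)
      (by linarith [hfU.2.1]) hfδ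
    have hqf : f.2 ∈ segment ℝ w s := mem_segment_of_cross_eq_zero hne
      (cross_eq_zero_of_mem_segment hw) hfc
      (cross_eq_zero_of_mem_segment (right_mem_segment ℝ _ _)) (by linarith) h.le (by linarith)
    exact ⟨f, hfU.1, ⟨hfδ.le, fun g hg => barrier_nonneg_of_mem_segment
      (hfK.2 w hw hwδ g hg.1) (hsK g hg) hqf⟩, h.le.trans hsmax⟩

lemma mem_innerEdges_or (hE : Arrangement E) (hδ : IsLowHeight E δ)
    {e : Plane × Plane} (he : e ∈ upEdges E) {w : Plane}
    (hw : w ∈ segment ℝ e.1 e.2) (hwδ : w.2 = δ) :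
    e ∈ innerEdges E δ ∨ ∃ f ∈ innerEdges E δ, barrier f w < 0 := by
  by_cases h : ∃ f ∈ upEdges E, barrier f w < 0
  · right
    obtain ⟨s, hs, hsK, f, hf, hfs, hfw⟩ := exists_mem_segment_forall_nonneg
      (hE.finite.subset (Set.sep_subset _ _)) barrier barrier_combo
      (fun f hf => (hδ.barrier_pos f hf).le) h
    have hsδ : s.2 = δ := by
      obtain ⟨x, y, -, -, hxy, rfl⟩ := hs
      simp only [Prod.snd_add, Prod.smul_snd, smul_eq_mul, hwδ]
      rw [← add_mul, hxy, one_mul]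
    refine ⟨f, ⟨hf, fun w' hw' hw'δ => ?_⟩, hfw⟩
    have hfc := hE.cross_eq_zero_of_barrier hf hfs
    have hfc' := cross_eq_zero_of_mem_segment hw'
    have : s = w' := by
      have hD : f.2.2 - f.1.2 ≠ 0 := by linarith [hf.2.1, hf.2.2]
      refine Prod.ext (mul_left_cancel₀ hD ?_) (hsδ.trans hw'δ.symm)
      simp only [cross, hsδ, hw'δ] at hfc hfc'
      linarith
    exact this ▸ hsK
  · left
    push Not at h
    refine ⟨he, fun w' hw' hw'δ => ?_⟩
    have hc := cross_eq_zero_of_mem_segment hw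
    have hc' := cross_eq_zero_of_mem_segment hw'
    have : w = w' := by
      have hD : e.2.2 - e.1.2 ≠ 0 := by linarith [he.2.1, he.2.2]
      refine Prod.ext (mul_left_cancel₀ hD ?_) (hwδ.trans hw'δ.symm)
      simp only [cross, hwδ, hw'δ] at hc hc'
      linarith
    exact this ▸ h

lemma innerEdge_lowPoint (hδ : IsLowHeight E δ) {e : Plane × Plane} (he : e ∈ innerEdges E δ) :
    ∃ w ∈ segment ℝ e.1 e.2, w.2 = δ ∧ w ∈ innerZone E δ := by
  obtain ⟨w, hw, hwδ⟩ := exists_mem_segment_snd_eq (p := e.1) (q := e.2) (h := δ)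
    (he.1.2.1.trans hδ.pos.le) (hδ.lt e he.1.1 he.1.2.2)
  exact ⟨w, hw, hwδ, hwδ.ge, fun f hf => he.2 w hw hwδ f hf.1⟩

lemma exists_vertex_mem_innerZone (hE : Arrangement E) (hδ : IsLowHeight E δ)
    (hne : ∃ e ∈ E, 0 < e.2.2) : ∃ e ∈ E, e.2 ∈ innerZone E δ := by
  rcases (innerEdges E δ).eq_empty_or_nonempty with h | ⟨f, hf⟩
  · obtain ⟨e, he, hpos⟩ := hne
    exact ⟨e, he, (hδ.lt e he hpos).le, by simp [h]⟩
  · by_cases hfz : f.2 ∈ innerZone E δ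
    · exact ⟨f, hf.1.1, hfz⟩
    obtain ⟨w, hw, hwδ, hwz⟩ := innerEdge_lowPoint hδ hf
    obtain ⟨g, hg, hgz, -⟩ := hE.exists_vertex_of_exit hδ hf.1.1 hw (right_mem_segment ℝ _ _)
      hwz (hδ.lt f hf.1.1 hf.1.2.2).le hfz
    exact ⟨g, hg, hgz⟩

/-- Some vertex of the open upper half-plane spans with the base `[0, 1] × {0}` a triangle whose
interior meets no edge. -/
theorem exists_empty_triangle (hE : Arrangement E) (hne : ∃ e ∈ E, 0 < e.2.2) :
    ∃ c ∈ E, 0 < c.2.2 ∧ ∀ e ∈ E, ∀ r ∈ segment ℝ e.1 e.2, ∀ x y z : ℝ, 0 < x → 0 < y → 0 < z →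
      x + y + z = 1 → r ≠ x • (0, 0) + y • (1, 0) + z • c.2 := by
  obtain ⟨δ, hδ⟩ := hE.exists_isLowHeight
  obtain ⟨c, ⟨hcE, hcz⟩, hmin⟩ := Set.exists_min_image {e ∈ E | e.2 ∈ innerZone E δ}
    (fun e => e.2.2) (hE.finite.subset (Set.sep_subset _ _))
    (hE.exists_vertex_mem_innerZone hδ hne)
  have hc0 : 0 < c.2.2 := hδ.pos.trans_le hcz.1
  refine ⟨c, hcE, hc0, ?_⟩
  suffices H : ∀ e ∈ E, e.1.2 ≤ e.2.2 → ∀ r ∈ segment ℝ e.1 e.2, ∀ x y z : ℝ, 0 < x → 0 < y →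
      0 < z → x + y + z = 1 → r ≠ x • (0, 0) + y • (1, 0) + z • c.2 by
    intro e he r hr
    rcases le_total e.1.2 e.2.2 with h | h
    · exact H e he h r hr
    · exact H (e.2, e.1) (hE.symm _ _ he) h r (segment_symm ℝ e.1 e.2 ▸ hr)
  intro e he hle r hr x y z hx hy hz hxyz hrc
  have hr2 : r.2 = z * c.2.2 := by simp [hrc]
  have hr0 : 0 < r.2 := by rw [hr2]; positivity
  have hrlt : r.2 < c.2.2 := by rw [hr2]; nlinarith
  have hrpos : ∀ f ∈ innerEdges E δ, 0 < barrier f r := by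
    intro f hf
    obtain ⟨hm, h0, h1⟩ := hE.barrier_base hf.1
    have hcf := hcz.2 f hf
    have hM : barrier f (1 / 2, 0) = 1 / 2 * barrier f (0, 0) + 1 / 2 * barrier f (1, 0) := by
      rw [← barrier_combo f (0, 0) (1, 0) _ _ (by norm_num)]
      simp
    have hrf : barrier f r = x * barrier f (0, 0) + y * barrier f (1, 0) + z * barrier f c.2 := by
      obtain rfl : x = 1 - y - z := by linarith
      simp only [hrc, barrier, cross, Prod.fst_add, Prod.snd_add, Prod.smul_fst, Prod.smul_snd,
        smul_eq_mul]
      ring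
    rw [hrf]
    rcases h0.eq_or_lt with h | h
    · have : 0 < barrier f (1, 0) := by linarith
      positivity
    · positivity
  have hexit : ∀ p ∈ segment ℝ e.1 e.2, r ∈ innerZone E δ → δ ≤ p.2 → p.2 ≤ r.2 →
      p ∈ innerZone E δ := by
    intro p hp hrz hpδ hpr
    by_contra hpz
    obtain ⟨g, hg, hgz, hgr⟩ := hE.exists_vertex_of_exit hδ he hr hp hrz hpδ hpz
    have := hmin g ⟨hg, hgz⟩
    rw [max_eq_left hpr] at hgr
    linarith
  have her : e.1.2 ≤ r.2 ∧ r.2 ≤ e.2.2 :=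
    ⟨by simpa [hle] using min_le_snd_of_mem_segment hr,
      by simpa [hle] using snd_le_max_of_mem_segment hr⟩
  rcases lt_or_ge 0 e.1.2 with hp | hp
  · have hsym := hE.symm _ _ he
    have hpδ := hδ.lt _ hsym hp
    dsimp only at hpδ
    have hez := hexit e.1 (left_mem_segment ℝ _ _)
      ⟨hpδ.le.trans her.1, fun f hf => (hrpos f hf).le⟩ hpδ.le her.1
    have := hmin _ ⟨hsym, hez⟩
    dsimp only at this
    linarith [her.1]
  · have heU : e ∈ upEdges E := ⟨he, hp, hr0.trans_le her.2⟩
    obtain ⟨w, hw, hwδ⟩ := exists_mem_segment_snd_eq (p := e.1) (q := e.2) (h := δ)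
      (hp.trans hδ.pos.le) (hδ.lt e he heU.2.2)
    rcases hE.mem_innerEdges_or hδ heU hw hwδ with hK | ⟨f, hfK, hfw⟩
    · linarith [hrpos e hK, barrier_eq_zero_of_mem_segment hr]
    rcases le_or_gt δ r.2 with hrδ | hrδ
    · have := (hexit w hw ⟨hrδ, fun f hf => (hrpos f hf).le⟩ hwδ.ge (hwδ.le.trans hrδ)).2 f hfK
      linarith
    · obtain ⟨s, hs, -, g, rfl, hfs, -⟩ := exists_mem_segment_forall_nonneg
        (Set.finite_singleton f) barrier barrier_combo (r := r) (p := w)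
        (by simpa using (hrpos f hfK).le) (by simpa using hfw)
      have hfU := hfK.1
      have hfδ := hδ.lt g hfU.1 hfU.2.2
      have hs0 : 0 < s.2 := (lt_min hr0 (hwδ ▸ hδ.pos)).trans_le (min_le_snd_of_mem_segment hs)
      have hsδ : s.2 ≤ δ := (snd_le_max_of_mem_segment hs).trans (max_le hrδ.le hwδ.le)
      have hsg : s ∈ segment ℝ g.1 g.2 := mem_segment_of_cross_eq_zero
        (by linarith [hfU.2.1, hfU.2.2] : g.1.2 ≠ g.2.2)
        (cross_eq_zero_of_mem_segment (left_mem_segment ℝ _ _))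
        (cross_eq_zero_of_mem_segment (right_mem_segment ℝ _ _))
        (hE.cross_eq_zero_of_barrier hfU hfs)
        (by linarith [hfU.2.1]) (by linarith) (by linarith [hfU.2.1, hfU.2.2])
      rcases hE.inter e he g hfU.1 s ((convex_segment _ _).segment_subset hr hw hs) hsg with
        h | h | h
      · rw [h] at hs0
        linarith [hfU.2.1]
      · rw [h] at hsδ
        linarith
      · rw [h] at hr
        linarith [hrpos g hfK, barrier_eq_zero_of_mem_segment hr]

end Arrangement

/-- Affine coordinates with `a` as origin, `b` as the point `(1, 0)`, and height proportional
to the signed area over the base `[a, b]`. -/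
noncomputable def baseCoord (a b : Plane) (σ : ℝ) (z : Plane) : Plane :=
  (((z.1 - a.1) * (b.1 - a.1) + (z.2 - a.2) * (b.2 - a.2)) /
    ((b.1 - a.1) ^ 2 + (b.2 - a.2) ^ 2), σ * cross a b z)

lemma sq_dist_pos {a b : Plane} (h : a ≠ b) : 0 < (b.1 - a.1) ^ 2 + (b.2 - a.2) ^ 2 := by
  by_contra! hle
  refine h (Prod.ext ?_ ?_) <;> nlinarith [sq_nonneg (b.1 - a.1), sq_nonneg (b.2 - a.2)]

lemma baseCoord_combo (a b : Plane) (σ : ℝ) (x y : Plane) {s t : ℝ} (h : s + t = 1) :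
    baseCoord a b σ (s • x + t • y) = s • baseCoord a b σ x + t • baseCoord a b σ y := by
  obtain rfl : s = 1 - t := by linarith
  ext
  · simp only [baseCoord, Prod.fst_add, Prod.snd_add, Prod.smul_fst, Prod.smul_snd, smul_eq_mul]
    ring
  · simp only [baseCoord, cross_combo a b x y h, Prod.snd_add, Prod.smul_snd, smul_eq_mul]
    ring

lemma baseCoord_left (a b : Plane) (σ : ℝ) : baseCoord a b σ a = (0, 0) := by
  simp [baseCoord, cross]

lemma baseCoord_right {a b : Plane} (h : a ≠ b) (σ : ℝ) : baseCoord a b σ b = (1, 0) := by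
  have := sq_dist_pos h
  ext
  · simp only [baseCoord]
    field_simp
  · simp only [baseCoord, cross]
    ring

lemma baseCoord_injective {a b : Plane} (h : a ≠ b) {σ : ℝ} (hσ : σ ≠ 0) :
    Function.Injective (baseCoord a b σ) := by
  intro x y hxy
  have hd := sq_dist_pos h
  have h1 := congrArg Prod.fst hxy
  have h2 := mul_left_cancel₀ hσ (congrArg Prod.snd hxy)
  simp only [baseCoord] at h1
  rw [div_left_inj' hd.ne'] at h1
  simp only [cross] at h2
  refine Prod.ext (mul_left_cancel₀ hd.ne' ?_) (mul_left_cancel₀ hd.ne' ?_)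
  · linear_combination (b.1 - a.1) * h1 - (b.2 - a.2) * h2
  · linear_combination (b.2 - a.2) * h1 + (b.1 - a.1) * h2

lemma mem_segment_baseCoord {a b : Plane} {σ : ℝ} {p q z : Plane}
    (h : z ∈ segment ℝ (baseCoord a b σ p) (baseCoord a b σ q)) :
    ∃ w ∈ segment ℝ p q, baseCoord a b σ w = z := by
  obtain ⟨s, t, hs, ht, hst, rfl⟩ := h
  exact ⟨_, ⟨s, t, hs, ht, hst, rfl⟩, baseCoord_combo a b σ p q hst⟩

lemma eq_combo_of_baseCoord {a b : Plane} (h : a ≠ b) {σ : ℝ} (hσ : σ ≠ 0) {x : ℝ} {w : Plane}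
    (hw : baseCoord a b σ w = (x, 0)) : w = (1 - x) • a + x • b := by
  apply baseCoord_injective h hσ
  rw [hw, baseCoord_combo a b σ a b (by ring), baseCoord_left, baseCoord_right h]
  simp

lemma collinear_of_cross_eq_zero {a b c : Plane} (h : a ≠ b) (hc : cross a b c = 0) :
    Collinear ℝ ({a, b, c} : Set Plane) := by
  rw [collinear_iff_of_mem (p₀ := a) (by simp)]
  refine ⟨b - a, ?_⟩
  have hc' := eq_combo_of_baseCoord h one_ne_zero (w := c) (x := (baseCoord a b 1 c).1)
    (by ext <;> simp [baseCoord, hc])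
  rintro p (rfl | rfl | rfl)
  · exact ⟨0, by simp⟩
  · exact ⟨1, by simp⟩
  · refine ⟨(baseCoord a b 1 p).1, hc'.trans ?_⟩
    rw [vadd_eq_add]
    module

lemma continuous_cross (p q : Plane) : Continuous (cross p q) := by
  unfold cross
  fun_prop

lemma dense_cross_ne_zero {p q : Plane} (h : p ≠ q) : Dense {z | cross p q z ≠ 0} := by
  intro z
  by_cases hz : cross p q z = 0
  · have hd := sq_dist_pos h
    have ht : Filter.Tendsto (fun ε : ℝ => (z.1 - ε * (q.2 - p.2), z.2 + ε * (q.1 - p.1)))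
        (nhdsWithin 0 (Set.Ioi 0)) (nhds z) := by
      refine Filter.Tendsto.mono_left ?_ nhdsWithin_le_nhds
      have : Continuous (fun ε : ℝ => (z.1 - ε * (q.2 - p.2), z.2 + ε * (q.1 - p.1))) := by
        fun_prop
      simpa using this.tendsto 0
    refine mem_closure_of_tendsto ht ?_
    filter_upwards [self_mem_nhdsWithin] with ε (hε : 0 < ε)
    have : cross p q (z.1 - ε * (q.2 - p.2), z.2 + ε * (q.1 - p.1)) =
        ε * ((q.1 - p.1) ^ 2 + (q.2 - p.2) ^ 2) := by
      simp only [cross] at hz ⊢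
      linear_combination hz
    exact this.trans_ne (by positivity)
  · exact subset_closure hz

/-- A preconnected set missing the frontier of `P` but meeting the interior lies in the
interior. -/
lemma subset_interior_of_isPreconnected {P S : Set Plane} (hS : IsPreconnected S)
    (hF : ∀ z ∈ S, z ∉ frontier P) (hne : ∃ z ∈ S, z ∈ interior P) : S ⊆ interior P := by
  intro z hz
  by_contra hzi
  have hzc : z ∈ (closure P)ᶜ := fun h => hF z hz ⟨h, hzi⟩
  obtain ⟨y, hyS, hy⟩ := hne
  obtain ⟨x, -, hxi, hxc⟩ := hS (interior P) (closure P)ᶜ isOpen_interior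
    isClosed_closure.isOpen_compl (fun x hx => by
      by_cases h : x ∈ interior P
      · exact Or.inl h
      · exact Or.inr fun hc => hF x hx ⟨hc, h⟩) ⟨y, hyS, hy⟩ ⟨z, hz, hzc⟩
  exact hxc (subset_closure (interior_subset hxi))

/-- The open triangle spanned by three points. -/
def openTriangle (a b c : Plane) : Set Plane :=
  {w | ∃ x y z : ℝ, 0 < x ∧ 0 < y ∧ 0 < z ∧ x + y + z = 1 ∧ w = x • a + y • b + z • c}

lemma convex_openTriangle (a b c : Plane) : Convex ℝ (openTriangle a b c) := by
  rintro _ ⟨x, y, z, hx, hy, hz, h, rfl⟩ _ ⟨x', y', z', hx', hy', hz', h', rfl⟩ s t hs ht hst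
  have key : ∀ u u' : ℝ, 0 < u → 0 < u' → 0 < s * u + t * u' := by
    intro u u' hu hu'
    rcases hs.eq_or_lt with rfl | hs
    · obtain rfl : t = 1 := by linarith
      linarith
    · positivity
  refine ⟨s * x + t * x', s * y + t * y', s * z + t * z', key _ _ hx hx', key _ _ hy hy',
    key _ _ hz hz', by linear_combination s * h + t * h' + hst, ?_⟩
  module

lemma mem_closure_openTriangle {a b c w : Plane} {x y z : ℝ} (hx : 0 ≤ x) (hy : 0 ≤ y)
    (hz : 0 ≤ z) (h : x + y + z = 1) (hw : w = x • a + y • b + z • c) :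
    w ∈ closure (openTriangle a b c) := by
  have ht : Filter.Tendsto (fun ε : ℝ => (1 - ε) • w + (ε / 3) • (a + b + c))
      (nhdsWithin 0 (Set.Ioi 0)) (nhds w) := by
    refine Filter.Tendsto.mono_left ?_ nhdsWithin_le_nhds
    have : Continuous (fun ε : ℝ => (1 - ε) • w + (ε / 3) • (a + b + c)) := by fun_prop
    simpa using this.tendsto 0
  refine mem_closure_of_tendsto ht ?_
  filter_upwards [Ioo_mem_nhdsGT (zero_lt_one' ℝ)] with ε hε
  have h1 : 0 ≤ 1 - ε := by linarith [hε.2]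
  have h3 : 0 < ε / 3 := by linarith [hε.1]
  refine ⟨(1 - ε) * x + ε / 3, (1 - ε) * y + ε / 3, (1 - ε) * z + ε / 3, by positivity,
    by positivity, by positivity, by linear_combination (1 - ε) * h, ?_⟩
  rw [hw]
  module

lemma convexHull_subset_closure_openTriangle (a b c : Plane) :
    convexHull ℝ {a, c, b} ⊆ closure (openTriangle a b c) := by
  refine convexHull_min ?_ (convex_openTriangle a b c).closure
  rintro w (rfl | rfl | rfl)
  · exact mem_closure_openTriangle (x := 1) (y := 0) (z := 0) (by simp) (by simp) (by simp)
      (by simp) (by simp)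
  · exact mem_closure_openTriangle (x := 0) (y := 0) (z := 1) (by simp) (by simp) (by simp)
      (by simp) (by simp)
  · exact mem_closure_openTriangle (x := 0) (y := 1) (z := 0) (by simp) (by simp) (by simp)
      (by simp) (by simp)

namespace SimplePolygon

variable {n : ℕ}

lemma neZero (SP : SimplePolygon n) : NeZero n := ⟨by have := SP.three_le; omega⟩

/-- The `m`-th edge. -/
def edge (SP : SimplePolygon n) (m : ZMod n) : Set Plane := segment ℝ (SP.v m) (SP.v (m + 1))

lemma mem_frontier_iff (SP : SimplePolygon n) {z : Plane} :
    z ∈ frontier SP.P ↔ ∃ m, z ∈ SP.edge m := by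
  rw [SP.frontier_eq, Set.mem_iUnion]
  rfl

lemma edge_subset_frontier (SP : SimplePolygon n) (m : ZMod n) : SP.edge m ⊆ frontier SP.P :=
  fun _ hz => SP.mem_frontier_iff.2 ⟨m, hz⟩

lemma v_mem_edge (SP : SimplePolygon n) (m : ZMod n) : SP.v m ∈ SP.edge m :=
  left_mem_segment ℝ _ _

lemma v_succ_mem_edge (SP : SimplePolygon n) (m : ZMod n) : SP.v (m + 1) ∈ SP.edge m :=
  right_mem_segment ℝ _ _

lemma eq_endpoint_of_mem_edges (SP : SimplePolygon n) {m l : ZMod n} (hml : m ≠ l) {z : Plane}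
    (hm : z ∈ SP.edge m) (hl : z ∈ SP.edge l) : z = SP.v l ∨ z = SP.v (l + 1) := by
  by_cases h1 : l = m + 1
  · subst h1
    have : z ∈ ({SP.v (m + 1)} : Set Plane) := SP.edges_consecutive m ▸ ⟨hm, hl⟩
    exact Or.inl this
  by_cases h2 : m = l + 1
  · subst h2
    have : z ∈ ({SP.v (l + 1)} : Set Plane) := SP.edges_consecutive l ▸ ⟨hl, hm⟩
    exact Or.inr this
  exact (Set.disjoint_left.1 (SP.edges_disjoint m l hml h1 h2) hm hl).elim

lemma ne_succ (SP : SimplePolygon n) (m : ZMod n) : m ≠ m + 1 := by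
  have : Fact (1 < n) := ⟨by have := SP.three_le; omega⟩
  simp

lemma cross_ne_zero (SP : SimplePolygon n) {a b c : ZMod n} (hab : a ≠ b) (hac : a ≠ c)
    (hbc : b ≠ c) : cross (SP.v a) (SP.v b) (SP.v c) ≠ 0 := fun h =>
  SP.no_three_collinear a b c hab hac hbc (collinear_of_cross_eq_zero (SP.inj.ne hab) h)

lemma isClosed_edge (SP : SimplePolygon n) (m : ZMod n) : IsClosed (SP.edge m) := by
  rw [edge, ← convexHull_pair]
  exact (Set.toFinite _).isClosed_convexHull ℝ

/-- Near a point of an edge that is not a vertex, the polygon lies on full sides of the edge. -/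
lemma exists_ball_side (SP : SimplePolygon n) {m : ZMod n} {x : Plane} (hx : x ∈ SP.edge m)
    (hxv : ∀ l, x ≠ SP.v l) : ∃ r > 0, ∀ τ : ℝ, ∀ y ∈ Metric.ball x r, y ∈ SP.P →
      0 < τ * cross (SP.v m) (SP.v (m + 1)) y → ∀ z ∈ Metric.ball x r,
      0 < τ * cross (SP.v m) (SP.v (m + 1)) z → z ∈ interior SP.P := by
  have := SP.neZero
  have hcl : IsClosed (⋃ l ∈ {l : ZMod n | l ≠ m}, SP.edge l) :=
    (Set.toFinite _).isClosed_biUnion fun l _ => SP.isClosed_edge l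
  have hxn : x ∈ (⋃ l ∈ {l : ZMod n | l ≠ m}, SP.edge l)ᶜ := by
    simp only [Set.mem_compl_iff, Set.mem_iUnion, not_exists]
    intro l hl hxl
    rcases SP.eq_endpoint_of_mem_edges (Ne.symm hl) hx hxl with h | h
    exacts [hxv _ h, hxv _ h]
  obtain ⟨r, hr, hball⟩ := Metric.isOpen_iff.1 hcl.isOpen_compl x hxn
  refine ⟨r, hr, fun τ y hy hyP hyτ z hz hzτ => ?_⟩
  have hfr : ∀ w ∈ Metric.ball x r ∩ {w | 0 < τ * cross (SP.v m) (SP.v (m + 1)) w},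
      w ∉ frontier SP.P := by
    rintro w ⟨hw, hwτ⟩ hwF
    obtain ⟨l, hl⟩ := SP.mem_frontier_iff.1 hwF
    by_cases hlm : l = m
    · subst hlm
      rw [Set.mem_ofPred_eq, cross_eq_zero_of_mem_segment hl, mul_zero] at hwτ
      exact hwτ.false
    · exact hball hw (Set.mem_biUnion (show l ∈ {l | l ≠ m} from hlm) hl)
  have hconv : Convex ℝ {w | 0 < τ * cross (SP.v m) (SP.v (m + 1)) w} := by
    intro u hu w hw s t hs ht hst
    rw [Set.mem_ofPred_eq] at hu hw ⊢
    rw [cross_combo _ _ _ _ hst]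
    rcases hs.eq_or_lt with rfl | hs
    · obtain rfl : t = 1 := by linarith
      linarith
    · nlinarith [mul_pos hs hu, mul_nonneg ht hw.le]
  refine subset_interior_of_isPreconnected ((convex_ball x r).inter hconv).isPreconnected hfr
    ⟨y, ⟨hy, hyτ⟩, ?_⟩ ⟨hz, hzτ⟩
  by_contra hyi
  exact hfr y ⟨hy, hyτ⟩ ⟨subset_closure hyP, hyi⟩

end SimplePolygon

lemma convex_setOf_cross_pos (a b : Plane) (σ : ℝ) : Convex ℝ {z | 0 < σ * cross a b z} := by
  intro u hu w hw s t hs ht hst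
  rw [Set.mem_ofPred_eq] at hu hw ⊢
  rw [cross_combo _ _ _ _ hst]
  rcases hs.eq_or_lt with rfl | hs
  · obtain rfl : t = 1 := by linarith
    linarith
  · nlinarith [mul_pos hs hu, mul_nonneg ht hw.le]

namespace SimplePolygon

variable {n : ℕ}

lemma ne_v_of_mem_openSegment (SP : SimplePolygon n) {i j : ZMod n} (hij : i ≠ j) {x : Plane}
    (hx : x ∈ openSegment ℝ (SP.v i) (SP.v j)) (l : ZMod n) : x ≠ SP.v l := by
  have hne := SP.inj.ne hij
  rintro rfl
  have hli : l ≠ i := by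
    rintro rfl
    exact hne (left_mem_openSegment_iff.1 hx)
  have hlj : l ≠ j := by
    rintro rfl
    exact hne (right_mem_openSegment_iff.1 hx)
  exact SP.cross_ne_zero hij hli.symm hlj.symm
    (cross_eq_zero_of_mem_segment (openSegment_subset_segment ℝ _ _ hx))

/-- The relative interior of a diagonal lies in the interior of the polygon. -/
lemma openSegment_subset_interior (SP : SimplePolygon n) {i j : ZMod n} (hij : i ≠ j)
    (hj : j ≠ i + 1) (hi : i ≠ j + 1) (hvis : Visible SP.P (SP.v i) (SP.v j)) :
    openSegment ℝ (SP.v i) (SP.v j) ⊆ interior SP.P := by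
  intro x hx
  by_contra hxi
  have hxs := openSegment_subset_segment ℝ _ _ hx
  obtain ⟨m, hm⟩ := SP.mem_frontier_iff.1 ⟨subset_closure (hvis hxs), hxi⟩
  have hm1 := SP.ne_succ m
  obtain ⟨r, hr, hside⟩ := SP.exists_ball_side hm (SP.ne_v_of_mem_openSegment hij hx)
  have hxc := cross_eq_zero_of_mem_segment hm
  set φ := cross (SP.v m) (SP.v (m + 1)) with hφ
  have hzero : ∀ l, φ (SP.v l) = 0 → l = m ∨ l = m + 1 := by
    intro l hl
    by_contra! h
    exact SP.cross_ne_zero hm1 h.1.symm h.2.symm hl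
  have hnb : ¬ (φ (SP.v i) = 0 ∧ φ (SP.v j) = 0) := by
    rintro ⟨h1, h2⟩
    rcases hzero i h1 with rfl | rfl <;> rcases hzero j h2 with rfl | rfl <;> simp_all
  obtain ⟨s, t, hs, ht, hst, hxst⟩ := id hx
  have hsum : s * φ (SP.v i) + t * φ (SP.v j) = 0 := by
    rw [← cross_combo _ _ _ _ hst, hxst, ← hφ, hxc]
  have hvi : φ (SP.v i) ≠ 0 := fun h => hnb ⟨h, by simpa [h, ht.ne'] using hsum⟩
  have hvj : φ (SP.v j) ≠ 0 := fun h => hnb ⟨by simpa [h, hs.ne'] using hsum, h⟩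
  have hnear : ∀ l, SP.v l ∈ segment ℝ (SP.v i) (SP.v j) → φ (SP.v l) ≠ 0 →
      ∀ z ∈ Metric.ball x r, 0 < φ (SP.v l) * φ z → z ∈ SP.P := by
    intro l hl hφl z hz hzl
    have ht : Filter.Tendsto (fun ε : ℝ => (1 - ε) • x + ε • SP.v l)
        (nhdsWithin 0 (Set.Ioi 0)) (nhds x) := by
      refine Filter.Tendsto.mono_left ?_ nhdsWithin_le_nhds
      have : Continuous (fun ε : ℝ => (1 - ε) • x + ε • SP.v l) := by fun_prop
      simpa using this.tendsto 0
    obtain ⟨ε, hεb, hε0, hε1⟩ := ((ht.eventually (Metric.ball_mem_nhds x hr)).and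
      (Ioo_mem_nhdsGT (zero_lt_one' ℝ))).exists
    refine interior_subset (hside (φ (SP.v l)) _ hεb (hvis ((convex_segment _ _).segment_subset
      hxs hl ⟨1 - ε, ε, by linarith, hε0.le, by ring, rfl⟩)) ?_ z hz hzl)
    rw [hφ, cross_combo _ _ _ _ (by ring), ← hφ, hxc, mul_zero, zero_add, mul_left_comm]
    have := mul_self_pos.2 hφl
    positivity
  have hball : Metric.ball x r ⊆ SP.P := by
    refine (Dense.open_subset_closure_inter (dense_cross_ne_zero (SP.inj.ne hm1))
      Metric.isOpen_ball).trans (closure_minimal ?_ SP.compact.isClosed)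
    rintro z ⟨hz, hzφ : φ z ≠ 0⟩
    have hprod : φ (SP.v i) * φ (SP.v j) < 0 := by
      have h1 : t * (φ (SP.v i) * φ (SP.v j)) = - (s * (φ (SP.v i) * φ (SP.v i))) := by
        linear_combination φ (SP.v i) * hsum
      have := mul_pos hs (mul_self_pos.2 hvi)
      by_contra! h
      nlinarith [mul_nonneg ht.le h]
    rcases lt_or_gt_of_ne (mul_ne_zero hvi hzφ) with h | h
    · refine hnear j (right_mem_segment ℝ _ _) hvj z hz ?_
      have h1 : 0 < φ (SP.v i) * φ z * (φ (SP.v i) * φ (SP.v j)) := mul_pos_of_neg_of_neg h hprod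
      have h2 := mul_self_pos.2 hvi
      have h3 : 0 < φ (SP.v i) * φ (SP.v i) * (φ (SP.v j) * φ z) := by linarith
      exact pos_of_mul_pos_right h3 h2.le
    · exact hnear i (left_mem_segment ℝ _ _) hvi z hz h
  exact hxi (mem_interior.2 ⟨_, hball, Metric.isOpen_ball, Metric.mem_ball_self hr⟩)

/-- The polygon contains one side of each of its edges near the midpoint. -/
lemma exists_side_edge (SP : SimplePolygon n) (m : ZMod n) : ∃ σ : ℝ, σ ≠ 0 ∧
    ∀ᶠ z in nhds ((1 / 2 : ℝ) • SP.v m + (1 / 2 : ℝ) • SP.v (m + 1)),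
      0 < σ * cross (SP.v m) (SP.v (m + 1)) z → z ∈ interior SP.P := by
  set x := (1 / 2 : ℝ) • SP.v m + (1 / 2 : ℝ) • SP.v (m + 1) with hx
  have hxo : x ∈ openSegment ℝ (SP.v m) (SP.v (m + 1)) :=
    ⟨1 / 2, 1 / 2, by norm_num, by norm_num, by norm_num, rfl⟩
  have hm1 := SP.ne_succ m
  have hxm : x ∈ SP.edge m := openSegment_subset_segment ℝ _ _ hxo
  obtain ⟨r, hr, hside⟩ := SP.exists_ball_side hxm (SP.ne_v_of_mem_openSegment hm1 hxo)
  have hxcl : x ∈ closure (interior SP.P) := by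
    rw [← SP.regular, ← SP.compact.isClosed.closure_eq]
    exact (SP.edge_subset_frontier m hxm).1
  obtain ⟨y, hyb, hyi⟩ := mem_closure_iff.1 hxcl _ Metric.isOpen_ball (Metric.mem_ball_self hr)
  obtain ⟨w, ⟨hwb, hwi⟩, hw⟩ := (dense_cross_ne_zero (SP.inj.ne hm1)).inter_open_nonempty _
    (Metric.isOpen_ball.inter isOpen_interior) ⟨y, hyb, hyi⟩
  refine ⟨cross (SP.v m) (SP.v (m + 1)) w, hw, ?_⟩
  filter_upwards [Metric.ball_mem_nhds x hr] with z hz hzpos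
  exact hside _ w hwb (interior_subset hwi) (mul_self_pos.2 hw) z hz hzpos

/-- The edges of a polygon in base coordinates form an arrangement. -/
lemma arrangement (SP : SimplePolygon n) {i j : ZMod n} (hij : i ≠ j) {σ : ℝ} (hσ : σ ≠ 0)
    (hbase : ∀ m, ∀ z ∈ openSegment ℝ (SP.v i) (SP.v j), z ∈ SP.edge m →
      (m = i ∧ m + 1 = j) ∨ (m = j ∧ m + 1 = i)) :
    Arrangement {e | ∃ m, e = (baseCoord (SP.v i) (SP.v j) σ (SP.v m),
        baseCoord (SP.v i) (SP.v j) σ (SP.v (m + 1))) ∨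
      e = (baseCoord (SP.v i) (SP.v j) σ (SP.v (m + 1)),
        baseCoord (SP.v i) (SP.v j) σ (SP.v m))} := by
  have := SP.neZero
  have hne := SP.inj.ne hij
  set φ := baseCoord (SP.v i) (SP.v j) σ with hφ
  have hseg : ∀ m e, (e = (φ (SP.v m), φ (SP.v (m + 1))) ∨ e = (φ (SP.v (m + 1)), φ (SP.v m))) →
      segment ℝ e.1 e.2 = segment ℝ (φ (SP.v m)) (φ (SP.v (m + 1))) := by
    rintro m e (rfl | rfl)
    · rfl
    · exact segment_symm ℝ _ _
  refine ⟨?_, ?_, ?_, ?_⟩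
  · refine ((Set.finite_range fun m => (φ (SP.v m), φ (SP.v (m + 1)))).union
      (Set.finite_range fun m => (φ (SP.v (m + 1)), φ (SP.v m)))).subset ?_
    rintro e ⟨m, rfl | rfl⟩
    exacts [Or.inl ⟨m, rfl⟩, Or.inr ⟨m, rfl⟩]
  · rintro p q ⟨m, h | h⟩ <;> obtain ⟨rfl, rfl⟩ := Prod.mk.inj h
    exacts [⟨m, Or.inr rfl⟩, ⟨m, Or.inl rfl⟩]
  · rintro e ⟨m, hm⟩ f ⟨l, hl⟩ z hze hzf
    rw [hseg m e hm] at hze ⊢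
    rw [hseg l f hl] at hzf ⊢
    by_cases hml : m = l
    · subst hml
      exact Or.inr (Or.inr rfl)
    obtain ⟨w, hw, rfl⟩ := mem_segment_baseCoord hze
    obtain ⟨w', hw', hww'⟩ := mem_segment_baseCoord hzf
    obtain rfl := baseCoord_injective hne hσ hww'
    rcases SP.eq_endpoint_of_mem_edges hml hw hw' with h | h <;> rcases hl with rfl | rfl <;>
      simp [h, hφ]
  · rintro e ⟨m, hm⟩ he x hx0 hx1 hxe
    rw [hseg m e hm] at hxe
    obtain ⟨w, hw, hwx⟩ := mem_segment_baseCoord hxe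
    have hwo : w ∈ openSegment ℝ (SP.v i) (SP.v j) :=
      ⟨1 - x, x, by linarith, hx0, by ring, (eq_combo_of_baseCoord hne hσ hwx).symm⟩
    have h1 : φ (SP.v i) = (0, 0) := baseCoord_left _ _ _
    have h2 : φ (SP.v j) = (1, 0) := baseCoord_right hne _
    rcases hbase m w hwo hw with ⟨h, h'⟩ | ⟨h, h'⟩ <;> rw [h', h] at hm <;>
      rcases hm with rfl | rfl <;> simp [h1, h2] at he

/-- On any side of a base `[v i, v j]` on which the polygon locally lies, some vertex spans with
the base a triangle contained in the polygon. -/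
theorem exists_triangle (SP : SimplePolygon n) {i j : ZMod n} (hij : i ≠ j) {σ : ℝ} (hσ : σ ≠ 0)
    (hbase : ∀ m, ∀ z ∈ openSegment ℝ (SP.v i) (SP.v j), z ∈ SP.edge m →
      (m = i ∧ m + 1 = j) ∨ (m = j ∧ m + 1 = i))
    (hseed : ∀ᶠ z in nhds ((1 / 2 : ℝ) • SP.v i + (1 / 2 : ℝ) • SP.v j),
      0 < σ * cross (SP.v i) (SP.v j) z → z ∈ interior SP.P) :
    ∃ l, 0 < σ * cross (SP.v i) (SP.v j) (SP.v l) ∧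
      convexHull ℝ {SP.v i, SP.v l, SP.v j} ⊆ SP.P ∧
      openSegment ℝ ((1 / 2 : ℝ) • SP.v i + (1 / 2 : ℝ) • SP.v j) (SP.v l) ⊆ interior SP.P := by
  have hne := SP.inj.ne hij
  set a := SP.v i with ha
  set b := SP.v j with hb
  set M := (1 / 2 : ℝ) • a + (1 / 2 : ℝ) • b with hM
  have hMc : cross a b M = 0 := cross_eq_zero_of_mem_segment
    ⟨1 / 2, 1 / 2, by norm_num, by norm_num, by norm_num, rfl⟩
  have hseed' : ∀ c, 0 < σ * cross a b c → ∃ ε : ℝ, 0 < ε ∧ ε < 1 ∧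
      (1 - ε) • M + ε • c ∈ interior SP.P := by
    intro c hc
    have ht : Filter.Tendsto (fun ε : ℝ => (1 - ε) • M + ε • c)
        (nhdsWithin 0 (Set.Ioi 0)) (nhds M) := by
      refine Filter.Tendsto.mono_left ?_ nhdsWithin_le_nhds
      have : Continuous (fun ε : ℝ => (1 - ε) • M + ε • c) := by fun_prop
      simpa using this.tendsto 0
    obtain ⟨ε, hε, hε0, hε1⟩ := ((ht.eventually hseed).and
      (Ioo_mem_nhdsGT (zero_lt_one' ℝ))).exists
    refine ⟨ε, hε0, hε1, hε ?_⟩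
    rw [cross_combo _ _ _ _ (by ring), hMc, mul_zero, zero_add, mul_left_comm]
    positivity
  have hup : ∃ l, 0 < σ * cross a b (SP.v l) := by
    by_contra! hall
    have hfr : ∀ z ∈ {z | 0 < σ * cross a b z}, z ∉ frontier SP.P := by
      intro z hz hzF
      obtain ⟨m, s, t, hs, ht, hst, rfl⟩ := SP.mem_frontier_iff.1 hzF
      rw [Set.mem_ofPred_eq, cross_combo _ _ _ _ hst] at hz
      nlinarith [mul_nonneg hs (neg_nonneg.2 (hall m)), mul_nonneg ht (neg_nonneg.2 (hall (m + 1)))]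
    have hd := sq_dist_pos hne
    have hval : ∀ h : ℝ, σ * cross a b (a.1 - h * (b.2 - a.2), a.2 + h * (b.1 - a.1)) =
        h * (σ * ((b.1 - a.1) ^ 2 + (b.2 - a.2) ^ 2)) := by
      intro h
      simp only [cross]
      ring
    have hex : ∀ C : ℝ, ∃ z, σ * cross a b z = C := by
      intro C
      refine ⟨_, (hval (C / (σ * ((b.1 - a.1) ^ 2 + (b.2 - a.2) ^ 2)))).trans ?_⟩
      field_simp
    obtain ⟨c, hc⟩ := hex 1
    have hc0 : 0 < σ * cross a b c := by linarith
    obtain ⟨ε, hε0, hε1, hε⟩ := hseed' c hc0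
    have hsub := subset_interior_of_isPreconnected
      (convex_setOf_cross_pos a b σ).isPreconnected hfr ⟨_, by
      rw [Set.mem_ofPred_eq, cross_combo _ _ _ _ (by ring), hMc, mul_zero, zero_add, mul_left_comm]
      positivity, hε⟩
    obtain ⟨B, hB⟩ := SP.compact.bddAbove_image (f := fun z => σ * cross a b z)
      ((continuous_cross a b).const_mul σ).continuousOn
    obtain ⟨z, hz⟩ := hex (max 1 (B + 1))
    have hz0 : 0 < σ * cross a b z := hz ▸ lt_max_of_lt_left one_pos
    have := hB ⟨z, interior_subset (hsub hz0), rfl⟩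
    simp only [hz] at this
    linarith [le_max_right 1 (B + 1)]
  obtain ⟨c, ⟨m, hm⟩, hc0, hempty⟩ := (SP.arrangement hij hσ hbase).exists_empty_triangle (by
    obtain ⟨l, hl⟩ := hup
    exact ⟨_, ⟨l, Or.inr rfl⟩, hl⟩)
  obtain ⟨l, hl⟩ : ∃ l, c.2 = baseCoord a b σ (SP.v l) := by
    rcases hm with rfl | rfl
    exacts [⟨m + 1, rfl⟩, ⟨m, rfl⟩]
  rw [hl] at hc0
  have hl0 : 0 < σ * cross a b (SP.v l) := hc0
  have hfr : ∀ z ∈ openTriangle a b (SP.v l), z ∉ frontier SP.P := by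
    rintro _ ⟨x, y, z, hx, hy, hz, hxyz, rfl⟩ hF
    obtain ⟨m', s, t, hs, ht, hst, hst'⟩ := SP.mem_frontier_iff.1 hF
    refine hempty _ ⟨m', Or.inl rfl⟩ _ ⟨s, t, hs, ht, hst, rfl⟩ x y z hx hy hz hxyz ?_
    rw [hl, ← baseCoord_left a b σ, ← baseCoord_right hne σ, ← ha, ← hb,
      ← baseCoord_combo _ _ _ _ _ hst, hst']
    obtain rfl : x = 1 - y - z := by linarith
    ext
    · simp only [baseCoord, Prod.fst_add, Prod.snd_add, Prod.smul_fst, Prod.smul_snd, smul_eq_mul]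
      ring
    · simp only [baseCoord, cross, Prod.fst_add, Prod.snd_add, Prod.smul_fst, Prod.smul_snd,
        smul_eq_mul]
      ring
  have hMl : openSegment ℝ M (SP.v l) ⊆ openTriangle a b (SP.v l) := by
    rintro _ ⟨s, t, hs, ht, hst, rfl⟩
    exact ⟨s / 2, s / 2, t, by positivity, by positivity, ht, by linarith, by rw [hM]; module⟩
  obtain ⟨ε, hε0, hε1, hε⟩ := hseed' _ hl0
  have hsub := subset_interior_of_isPreconnected (convex_openTriangle _ _ _).isPreconnected hfr
    ⟨_, hMl ⟨1 - ε, ε, by linarith, hε0, by ring, rfl⟩, hε⟩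
  exact ⟨l, hl0, (convexHull_subset_closure_openTriangle _ _ _).trans
    (closure_minimal (hsub.trans interior_subset) SP.compact.isClosed), hMl.trans hsub⟩

end SimplePolygon

/-- A point of the plane as a complex number. -/
def toComplex (z : Plane) : ℂ := ⟨z.1, z.2⟩

lemma continuous_toComplex : Continuous toComplex :=
  Complex.equivRealProdCLM.symm.continuous

lemma toComplex_injective : Function.Injective toComplex := fun _ _ h =>
  Prod.ext (congrArg Complex.re h) (congrArg Complex.im h)

lemma toComplex_sub_ne_zero {x y : Plane} (h : x ≠ y) : toComplex x - toComplex y ≠ 0 :=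
  sub_ne_zero.2 (toComplex_injective.ne h)

/-- The signed angle in `(-π, π]` under which `[p, q]` is seen from `x`. -/
noncomputable def subtended (p q x : Plane) : ℝ :=
  Complex.arg ((toComplex q - toComplex x) / (toComplex p - toComplex x))

lemma div_mem_slitPlane {p q x : Plane} (h : x ∉ segment ℝ p q) :
    (toComplex q - toComplex x) / (toComplex p - toComplex x) ∈ Complex.slitPlane := by
  have hp : x ≠ p := by
    rintro rfl
    exact h (left_mem_segment ℝ _ _)
  have hp0 := toComplex_sub_ne_zero hp.symm
  set w := (toComplex q - toComplex x) / (toComplex p - toComplex x) with hw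
  by_contra hs
  rw [Complex.mem_slitPlane_iff, not_or, not_lt, not_not] at hs
  obtain ⟨hre, him⟩ := hs
  rw [eq_div_iff hp0] at hw
  have h1 := congrArg Complex.re hw
  have h2 := congrArg Complex.im hw
  simp only [Complex.mul_re, Complex.mul_im, him, Complex.sub_re, Complex.sub_im, toComplex] at h1 h2
  have hpos : 0 < 1 - w.re := by linarith
  refine h ⟨-w.re / (1 - w.re), 1 / (1 - w.re), div_nonneg (by linarith) hpos.le, by positivity,
    by field_simp; ring, ?_⟩
  ext
  · simp only [Prod.fst_add, Prod.smul_fst, smul_eq_mul]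
    field_simp
    linarith
  · simp only [Prod.snd_add, Prod.smul_snd, smul_eq_mul]
    field_simp
    linarith

lemma continuousAt_subtended {p q x : Plane} (h : x ∉ segment ℝ p q) :
    ContinuousAt (subtended p q) x := by
  have hp : x ≠ p := by
    rintro rfl
    exact h (left_mem_segment ℝ _ _)
  have hc := continuous_toComplex.continuousAt (x := x)
  exact ContinuousAt.comp (f := fun x => (toComplex q - toComplex x) / (toComplex p - toComplex x))
    (Complex.continuousAt_arg (div_mem_slitPlane h))
    ((continuousAt_const.sub hc).div (continuousAt_const.sub hc)
      (toComplex_sub_ne_zero hp.symm))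

lemma subtended_im (a b x : Plane) :
    ((toComplex a - toComplex x) / (toComplex b - toComplex x)).im =
      -cross a b x / Complex.normSq (toComplex b - toComplex x) := by
  rw [Complex.div_im]
  simp only [Complex.sub_re, Complex.sub_im, toComplex, cross]
  ring

lemma tendsto_div_midpoint {a b : Plane} (h : a ≠ b) (s : Set Plane) :
    Filter.Tendsto (fun x => (toComplex a - toComplex x) / (toComplex b - toComplex x))
      (nhdsWithin ((1 / 2 : ℝ) • a + (1 / 2 : ℝ) • b) s) (nhds (-1)) := by
  set M := (1 / 2 : ℝ) • a + (1 / 2 : ℝ) • b with hM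
  have h0 : toComplex a - toComplex M = - (toComplex b - toComplex M) := by
    apply Complex.ext
    · simp only [toComplex, hM, Complex.sub_re, Complex.neg_re, Prod.fst_add, Prod.smul_fst,
        smul_eq_mul]
      ring
    · simp only [toComplex, hM, Complex.sub_im, Complex.neg_im, Prod.snd_add, Prod.smul_snd,
        smul_eq_mul]
      ring
  have hbM : toComplex b - toComplex M ≠ 0 := by
    refine toComplex_sub_ne_zero fun hb => h ?_
    have : a = (2 : ℝ) • M - b := by rw [hM]; module
    rw [this, ← hb]
    module
  have hc := continuous_toComplex.tendsto M
  have ht := ((tendsto_const_nhds (x := toComplex a)).sub hc).div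
    ((tendsto_const_nhds (x := toComplex b)).sub hc) hbM
  rw [h0, neg_div, div_self hbM] at ht
  exact ht.mono_left nhdsWithin_le_nhds

lemma tendsto_subtended_pos {a b : Plane} (h : a ≠ b) :
    Filter.Tendsto (subtended b a)
      (nhdsWithin ((1 / 2 : ℝ) • a + (1 / 2 : ℝ) • b) {x | 0 < cross a b x})
      (nhds (-Real.pi)) := by
  refine (Complex.tendsto_arg_nhdsWithin_im_neg_of_re_neg_of_im_zero (z := -1) (by simp)
    (by simp)).comp (tendsto_nhdsWithin_iff.2 ⟨tendsto_div_midpoint h _, ?_⟩)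
  filter_upwards [self_mem_nhdsWithin] with x (hx : 0 < cross a b x)
  rw [subtended_im]
  refine div_neg_of_neg_of_pos (by linarith) (Complex.normSq_pos.2 (toComplex_sub_ne_zero ?_))
  rintro rfl
  simp only [cross] at hx
  linarith

lemma tendsto_subtended_neg {a b : Plane} (h : a ≠ b) :
    Filter.Tendsto (subtended b a)
      (nhdsWithin ((1 / 2 : ℝ) • a + (1 / 2 : ℝ) • b) {x | cross a b x < 0})
      (nhds Real.pi) := by
  refine (Complex.tendsto_arg_nhdsWithin_im_nonneg_of_re_neg_of_im_zero (z := -1) (by simp)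
    (by simp)).comp (tendsto_nhdsWithin_iff.2 ⟨tendsto_div_midpoint h _, ?_⟩)
  filter_upwards [self_mem_nhdsWithin] with x (hx : cross a b x < 0)
  rw [subtended_im]
  exact div_nonneg (by linarith) (Complex.normSq_nonneg _)

/-- The total angle under which the closed polygonal curve through `w 0, …, w k` is seen. -/
noncomputable def totalAngle (w : ℕ → Plane) (k : ℕ) (x : Plane) : ℝ :=
  ∑ l ∈ Finset.range k, subtended (w l) (w (l + 1)) x + subtended (w k) (w 0) x

lemma totalAngle_mem_zmultiples {w : ℕ → Plane} {k : ℕ} {x : Plane} (hx : ∀ l ≤ k, w l ≠ x) :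
    totalAngle w k x ∈ AddSubgroup.zmultiples (2 * Real.pi) := by
  have h0 : ((totalAngle w k x : ℝ) : Real.Angle) = 0 := by
    have hsum : ∀ m ≤ k, ((∑ l ∈ Finset.range m, subtended (w l) (w (l + 1)) x : ℝ) : Real.Angle) =
        Complex.arg (toComplex (w m) - toComplex x) -
          Complex.arg (toComplex (w 0) - toComplex x) := by
      intro m
      induction m with
      | zero => simp
      | succ m ih =>
        intro hm
        rw [Finset.sum_range_succ, Real.Angle.coe_add, ih (by omega), subtended,
          Complex.arg_div_coe_angle (toComplex_sub_ne_zero (hx _ hm))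
            (toComplex_sub_ne_zero (hx _ (by omega)))]
        abel
    rw [totalAngle, Real.Angle.coe_add, hsum k le_rfl, subtended,
      Complex.arg_div_coe_angle (toComplex_sub_ne_zero (hx _ (by omega)))
        (toComplex_sub_ne_zero (hx _ le_rfl))]
    abel
  rw [← Real.Angle.coe_zero, Real.Angle.angle_eq_iff_two_pi_dvd_sub] at h0
  obtain ⟨m, hm⟩ := h0
  refine AddSubgroup.mem_zmultiples_iff.2 ⟨m, ?_⟩
  rw [zsmul_eq_mul]
  linarith

lemma totalAngle_eq_of_isPreconnected {w : ℕ → Plane} {k : ℕ} {S : Set Plane}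
    (hS : IsPreconnected S) (hw : ∀ x ∈ S, ∀ l < k, x ∉ segment ℝ (w l) (w (l + 1)))
    (hbase : ∀ x ∈ S, x ∉ segment ℝ (w k) (w 0)) {x y : Plane} (hx : x ∈ S) (hy : y ∈ S) :
    totalAngle w k x = totalAngle w k y := by
  refine hS.constant_of_mapsTo (T := (AddSubgroup.zmultiples (2 * Real.pi) : Set ℝ))
    (isDiscrete_iff_discreteTopology.2 (inferInstanceAs
      (DiscreteTopology (AddSubgroup.zmultiples (2 * Real.pi))))) ?_ ?_ hx hy
  · intro z hz
    refine ContinuousAt.continuousWithinAt (ContinuousAt.add ?_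
      (continuousAt_subtended (hbase z hz)))
    exact tendsto_finsetSum _ fun l hl =>
      continuousAt_subtended (hw z hz l (Finset.mem_range.1 hl))
  · intro z hz
    refine totalAngle_mem_zmultiples fun l hl => ?_
    rintro rfl
    rcases hl.lt_or_eq with h | rfl
    · exact hw _ hz l h (left_mem_segment ℝ _ _)
    · exact hbase _ hz (left_mem_segment ℝ _ _)

/-- Approaching the midpoint `M` of the last side of a closed polygonal curve along `[c, M]`. -/
lemma totalAngle_eq_add {w : ℕ → Plane} {k : ℕ} {D : Set Plane} {c : Plane} {L : ℝ}
    (hD : Convex ℝ D) (hD0 : ∀ x ∈ D, cross (w 0) (w k) x ≠ 0)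
    (hDc : ∀ t : ℝ, 0 < t → t ≤ 1 →
      (1 - t) • ((1 / 2 : ℝ) • w 0 + (1 / 2 : ℝ) • w k) + t • c ∈ D)
    (hL : Filter.Tendsto (subtended (w k) (w 0))
      (nhdsWithin ((1 / 2 : ℝ) • w 0 + (1 / 2 : ℝ) • w k) D) (nhds L))
    (hw : ∀ x ∈ segment ℝ ((1 / 2 : ℝ) • w 0 + (1 / 2 : ℝ) • w k) c, ∀ l < k,
      x ∉ segment ℝ (w l) (w (l + 1))) :
    totalAngle w k c = ∑ l ∈ Finset.range k, subtended (w l) (w (l + 1))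
      ((1 / 2 : ℝ) • w 0 + (1 / 2 : ℝ) • w k) + L := by
  set M := (1 / 2 : ℝ) • w 0 + (1 / 2 : ℝ) • w k with hM
  set S := segment ℝ M c ∩ D with hS
  have hSc : Convex ℝ S := (convex_segment _ _).inter hD
  have hcS : c ∈ S := ⟨right_mem_segment ℝ _ _, by simpa using hDc 1 one_pos le_rfl⟩
  have hMS : M ∈ closure S := by
    have ht : Filter.Tendsto (fun ε : ℝ => (1 - ε) • M + ε • c)
        (nhdsWithin 0 (Set.Ioi 0)) (nhds M) := by
      refine Filter.Tendsto.mono_left ?_ nhdsWithin_le_nhds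
      have : Continuous (fun ε : ℝ => (1 - ε) • M + ε • c) := by fun_prop
      simpa using this.tendsto 0
    refine mem_closure_of_tendsto ht ?_
    filter_upwards [Ioo_mem_nhdsGT (zero_lt_one' ℝ)] with ε hε
    exact ⟨⟨1 - ε, ε, by linarith [hε.2], hε.1.le, by ring, rfl⟩, hDc ε hε.1 hε.2.le⟩
  have := mem_closure_iff_nhdsWithin_neBot.1 hMS
  have hconst : Filter.Tendsto (totalAngle w k) (nhdsWithin M S) (nhds (totalAngle w k c)) := by
    refine tendsto_const_nhds.congr' ?_
    filter_upwards [self_mem_nhdsWithin] with x hx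
    refine totalAngle_eq_of_isPreconnected hSc.isPreconnected (fun y hy => hw y hy.1) ?_ hcS hx
    intro y hy hyb
    rw [segment_symm] at hyb
    exact hD0 y hy.2 (cross_eq_zero_of_mem_segment hyb)
  refine tendsto_nhds_unique hconst (Filter.Tendsto.add ?_
    (hL.mono_left (nhdsWithin_mono _ Set.inter_subset_right)))
  exact tendsto_finsetSum _ fun l hl => ((continuousAt_subtended
    (hw M (left_mem_segment ℝ _ _) l (Finset.mem_range.1 hl))).tendsto).mono_left
      nhdsWithin_le_nhds

/-- Crossing a side of a closed polygonal curve changes the total angle. -/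
lemma totalAngle_ne {w : ℕ → Plane} {k : ℕ} {p q : Plane} (hne : w 0 ≠ w k)
    (hp : 0 < cross (w 0) (w k) p) (hq : cross (w 0) (w k) q < 0)
    (hwp : ∀ x ∈ segment ℝ ((1 / 2 : ℝ) • w 0 + (1 / 2 : ℝ) • w k) p, ∀ l < k,
      x ∉ segment ℝ (w l) (w (l + 1)))
    (hwq : ∀ x ∈ segment ℝ ((1 / 2 : ℝ) • w 0 + (1 / 2 : ℝ) • w k) q, ∀ l < k,
      x ∉ segment ℝ (w l) (w (l + 1))) :
    totalAngle w k p ≠ totalAngle w k q := by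
  have hM : cross (w 0) (w k) ((1 / 2 : ℝ) • w 0 + (1 / 2 : ℝ) • w k) = 0 :=
    cross_eq_zero_of_mem_segment ⟨1 / 2, 1 / 2, by norm_num, by norm_num, by norm_num, rfl⟩
  have h1 := totalAngle_eq_add (D := {z | 0 < cross (w 0) (w k) z})
    (by simpa using convex_setOf_cross_pos (w 0) (w k) 1) (fun x hx => ne_of_gt hx)
    (fun t ht _ => by
      rw [Set.mem_ofPred_eq, cross_combo _ _ _ _ (by ring), hM, mul_zero, zero_add]
      positivity) (tendsto_subtended_pos hne) hwp
  have h2 := totalAngle_eq_add (D := {z | cross (w 0) (w k) z < 0})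
    (by simpa using convex_setOf_cross_pos (w 0) (w k) (-1)) (fun x hx => ne_of_lt hx)
    (fun t ht _ => by
      rw [Set.mem_ofPred_eq, cross_combo _ _ _ _ (by ring), hM, mul_zero, zero_add]
      exact mul_neg_of_pos_of_neg ht hq) (tendsto_subtended_neg hne) hwq
  linarith [Real.pi_pos]

namespace SimplePolygon

variable {n : ℕ}

lemma eq_or_eq_of_v_mem_edge (SP : SimplePolygon n) {l m : ZMod n} (h : SP.v l ∈ SP.edge m) :
    l = m ∨ l = m + 1 := by
  by_cases hlm : l = m
  · exact Or.inl hlm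
  rcases SP.eq_endpoint_of_mem_edges hlm (SP.v_mem_edge l) h with h | h
  exacts [Or.inl (SP.inj h), Or.inr (SP.inj h)]

lemma add_natCast_inj (i : ZMod n) {s t : ℕ} (hs : s < n) (ht : t < n)
    (h : i + (s : ZMod n) = i + (t : ZMod n)) : s = t := by
  have h' := congrArg ZMod.val (add_left_cancel h)
  rwa [ZMod.val_cast_of_lt hs, ZMod.val_cast_of_lt ht] at h'

/-- The vertices beyond a diagonal see the chain cut off by it under the same total angle. -/
lemma totalAngle_eq (SP : SimplePolygon n) {i : ZMod n} {k : ℕ} (hk : 2 ≤ k)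
    (hint : openSegment ℝ (SP.v i) (SP.v (i + (k : ZMod n))) ⊆ interior SP.P) {t : ℕ}
    (hkt : k < t) (htn : t < n) :
    totalAngle (fun l : ℕ => SP.v (i + (l : ZMod n))) k (SP.v (i + (t : ZMod n))) =
      totalAngle (fun l : ℕ => SP.v (i + (l : ZMod n))) k (SP.v (i + ((k + 1 : ℕ) : ZMod n))) := by
  induction t, hkt using Nat.le_induction with
  | base => rfl
  | succ t hkt ih =>
    have hdisj : ∀ x ∈ SP.edge (i + (t : ZMod n)), ∀ l < k, x ∉ SP.edge (i + (l : ZMod n)) := by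
      intro x hx l hl hxl
      refine Set.disjoint_left.1 (SP.edges_disjoint (i + (t : ZMod n)) (i + (l : ZMod n))
        ?_ ?_ ?_) hx hxl <;> intro h
      · have := add_natCast_inj i (by omega) (by omega) h
        omega
      · have := add_natCast_inj i (s := l) (t := t + 1) (by omega) (by omega)
          (by push_cast; rw [h]; ring)
        omega
      · have := add_natCast_inj i (s := t) (t := l + 1) (by omega) (by omega)
          (by push_cast; rw [h]; ring)
        omega
    rw [← ih (by omega)]
    refine totalAngle_eq_of_isPreconnected (S := SP.edge (i + (t : ZMod n)))
      (convex_segment _ _).isPreconnected ?_ ?_ ?_ (SP.v_mem_edge _)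
    · intro x hx l hl
      simpa [edge, add_assoc] using hdisj x hx l hl
    · intro x hx hxs
      simp only [Nat.cast_zero, add_zero] at hxs
      rw [segment_symm, ← insert_endpoints_openSegment] at hxs
      rcases hxs with rfl | rfl | hxs
      · exact hdisj _ hx 0 (by omega) (by simpa using SP.v_mem_edge i)
      · refine hdisj _ hx (k - 1) (by omega) ?_
        have := SP.v_succ_mem_edge (i + ((k - 1 : ℕ) : ZMod n))
        rwa [add_assoc, ← Nat.cast_succ, Nat.succ_eq_add_one, Nat.sub_add_cancel (by omega)] at this
      · exact (SP.edge_subset_frontier _ hx).2 (hint hxs)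
    · have := SP.v_succ_mem_edge (i + (t : ZMod n))
      rwa [add_assoc, ← Nat.cast_succ] at this

lemma exists_chain_triangle (SP : SimplePolygon n) (i : ZMod n) {k : ℕ} (hk2 : 2 ≤ k)
    (hkn : k ≤ n - 1) (hvis : Visible SP.P (SP.v i) (SP.v (i + (k : ZMod n)))) :
    ∃ t : ℕ, 1 ≤ t ∧ t ≤ k - 1 ∧
      convexHull ℝ {SP.v i, SP.v (i + (t : ZMod n)), SP.v (i + (k : ZMod n))} ⊆ SP.P := by
  have := SP.neZero
  have hn := SP.three_le
  have hij : i ≠ i + (k : ZMod n) := fun h => by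
    have := add_natCast_inj i (s := 0) (t := k) (by omega) (by omega) (by simpa using h)
    omega
  have hidx : ∀ l, cross (SP.v i) (SP.v (i + (k : ZMod n))) (SP.v l) ≠ 0 →
      ∃ t : ℕ, l = i + (t : ZMod n) ∧ 1 ≤ t ∧ t < n ∧ t ≠ k := by
    intro l hl
    refine ⟨(l - i).val, by simp, ?_, ZMod.val_lt _, ?_⟩
    · by_contra! h
      have h0 : l = i := sub_eq_zero.1 ((ZMod.val_eq_zero _).1 (by omega))
      rw [h0] at hl
      exact hl (cross_eq_zero_of_mem_segment (left_mem_segment ℝ _ _))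
    · intro h
      have h0 : l = i + (k : ZMod n) := by rw [← h]; simp
      rw [h0] at hl
      exact hl (cross_eq_zero_of_mem_segment (right_mem_segment ℝ _ _))
  rcases hkn.eq_or_lt with hk | hk
  · have hji : i + (k : ZMod n) + 1 = i := by
      rw [add_assoc, ← Nat.cast_succ, hk, Nat.succ_eq_add_one, Nat.sub_add_cancel (by omega)]
      simp
    obtain ⟨σ, hσ, hside⟩ := SP.exists_side_edge (i + (k : ZMod n))
    rw [hji] at hside
    obtain ⟨l, hl, hsub, -⟩ := SP.exists_triangle hij.symm hσ (fun m z hz hzm => by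
      by_cases hm : m = i + (k : ZMod n)
      · exact Or.inl ⟨hm, by rw [hm, hji]⟩
      rcases SP.eq_endpoint_of_mem_edges hm hzm (l := i + (k : ZMod n)) (by
        rw [edge, hji]
        exact openSegment_subset_segment ℝ _ _ hz) with h | h <;>
      exact absurd h (SP.ne_v_of_mem_openSegment hij.symm hz _)) hside
    obtain ⟨t, rfl, ht1, htn, htk⟩ := hidx l (by
      intro h
      have : cross (SP.v (i + (k : ZMod n))) (SP.v i) (SP.v l) = 0 := by
        simp only [cross] at h ⊢
        linarith
      rw [this, mul_zero] at hl
      exact lt_irrefl _ hl)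
    refine ⟨t, ht1, by omega, ?_⟩
    convert hsub using 2
    grind
  · have hint := SP.openSegment_subset_interior hij (fun h => by
        have := add_natCast_inj i (s := k) (t := 1) (by omega) (by omega) (by simpa using h)
        omega) (fun h => by
        have := add_natCast_inj i (s := 0) (t := k + 1) (by omega) (by omega)
          (by push_cast; rw [← add_assoc, ← h]; simp)
        omega) hvis
    set M := (1 / 2 : ℝ) • SP.v i + (1 / 2 : ℝ) • SP.v (i + (k : ZMod n)) with hM
    have hMi : M ∈ interior SP.P :=
      hint ⟨1 / 2, 1 / 2, by norm_num, by norm_num, by norm_num, rfl⟩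
    by_contra! hno
    have hside : ∀ σ : ℝ, σ ≠ 0 → ∃ t : ℕ, k < t ∧ t < n ∧
        0 < σ * cross (SP.v i) (SP.v (i + (k : ZMod n))) (SP.v (i + (t : ZMod n))) ∧
        ∀ x ∈ segment ℝ M (SP.v (i + (t : ZMod n))), ∀ l < k,
          x ∉ SP.edge (i + (l : ZMod n)) := by
      intro σ hσ
      obtain ⟨l, hl, hsub, hopen⟩ := SP.exists_triangle hij hσ
        (fun m z hz hzm => absurd (hint hz) (SP.edge_subset_frontier m hzm).2)
        (by filter_upwards [isOpen_interior.mem_nhds hMi] with z hz _ using hz)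
      obtain ⟨t, rfl, ht1, htn, htk⟩ := hidx l (right_ne_zero_of_mul hl.ne')
      have hkt : k < t := by
        by_contra! h
        exact hno t ht1 (by omega) hsub
      refine ⟨t, hkt, htn, hl, fun x hx l hlk hxl => ?_⟩
      rw [← insert_endpoints_openSegment] at hx
      rcases hx with rfl | rfl | hx
      · exact (SP.edge_subset_frontier _ hxl).2 hMi
      · rcases SP.eq_or_eq_of_v_mem_edge hxl with h | h
        · have := add_natCast_inj i htn (by omega) h
          omega
        · have := add_natCast_inj i (t := l + 1) htn (by omega) (by push_cast; rw [h]; ring)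
          omega
      · exact (SP.edge_subset_frontier _ hxl).2 (hopen hx)
    obtain ⟨t, hkt, htn, ht, hwt⟩ := hside 1 one_ne_zero
    obtain ⟨s, hks, hsn, hs, hws⟩ := hside (-1) (by norm_num)
    refine totalAngle_ne (w := fun l : ℕ => SP.v (i + (l : ZMod n))) (k := k)
      (p := SP.v (i + (t : ZMod n))) (q := SP.v (i + (s : ZMod n))) ?_ ?_ ?_ ?_ ?_
      ((SP.totalAngle_eq hk2 hint hkt htn).trans (SP.totalAngle_eq hk2 hint hks hsn).symm)
    · simpa using SP.inj.ne hij
    · simpa using ht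
    · simpa using hs
    · simpa [edge, add_assoc, hM] using hwt
    · simpa [edge, add_assoc, hM] using hws

end SimplePolygon

/-- Lemma 1 (triangle witness characterization of visibility): for `j = i + k` with
`2 ≤ k ≤ n - 1`, the vertex `v i` is visible to `v j` iff some vertex `v (i+t)` of the
chain `ch(v (i+1), v (j-1))`, i.e. with `1 ≤ t ≤ k - 1`, is a triangle witness for
`(v i, v j)`: it is visible to both `v i` and `v j`, and the solid triangle
`conv {v i, v (i+t), v j}` is contained in `P`. -/
theorem visible_iff_exists_triangle_witness {n : ℕ} (SP : SimplePolygon n)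
    (i : ZMod n) (k : ℕ) (hk2 : 2 ≤ k) (hkn : k ≤ n - 1) :
    Visible SP.P (SP.v i) (SP.v (i + (k : ZMod n))) ↔
      ∃ t : ℕ, 1 ≤ t ∧ t ≤ k - 1 ∧
        Visible SP.P (SP.v (i + (t : ZMod n))) (SP.v i) ∧
        Visible SP.P (SP.v (i + (t : ZMod n))) (SP.v (i + (k : ZMod n))) ∧
        convexHull ℝ ({SP.v i, SP.v (i + (t : ZMod n)), SP.v (i + (k : ZMod n))} : Set Plane)
          ⊆ SP.P := by
  constructor
  · intro hvis
    obtain ⟨t, ht1, htk, hsub⟩ := SP.exists_chain_triangle i hk2 hkn hvis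
    refine ⟨t, ht1, htk, ?_, ?_, hsub⟩
    · exact (segment_subset_convexHull (by simp) (by simp)).trans hsub
    · exact (segment_subset_convexHull (by simp) (by simp)).trans hsub
  · rintro ⟨t, -, -, -, -, hsub⟩
    exact (segment_subset_convexHull (by simp) (by simp)).trans hsub
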